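/- For the multiset with all multiplicities 2, i.e. 𝐦 = (2,2,...,2) (n twos), the bivariate descent polynomial admits an expansion A_𝐦(x,y) = y·Σ_{k=1}^{n} b(n,k) (xy)^k (x+y)^{2n-2k} with nonnegative integers b(n,k); in particular A_𝐦(x) = Σ_k b(n,k) x^k (1+x)^{2n-2k} is γ-positive, hence symmetric and unimodal with mode ⌊(2n+1)/2⌋ or centered. -/

import Mathlib

open MvPolynomial

/-- Number of descents in `a :: rest`, counting consecutive pairs. -/
def desAux : List ℕ → ℕ
  | a :: b :: t => (if b < a then 1 else 0) + desAux (b :: t)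
  | _ => 0

/-- The descent number of a word `w = π₁…π_m`, with the boundary convention
`π₀ = π_{m+1} = 0`. -/
def des (w : List ℕ) : ℕ := desAux (0 :: (w ++ [0]))

/-- The list of all distinct arrangements (multipermutations) of a multiset. -/
noncomputable def arrangements (M : Multiset ℕ) : List (List ℕ) :=
  M.toList.permutations.dedup

/-- The multiset `{1^{m₁}, 2^{m₂}, …, n^{m_n}}` encoded by the list of
multiplicities `ms = [m₁, …, m_n]`. -/
def msetOf (ms : List ℕ) : Multiset ℕ :=
  ((List.range ms.length).flatMap fun i => List.replicate (ms.getD i 0) (i + 1) : List ℕ)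

/-- The homogenized multiset Eulerian polynomial
`A_𝐦(x,y) = Σ_π x^{des π} y^{m+1-des π}`. -/
noncomputable def Abi (ms : List ℕ) : MvPolynomial (Fin 2) ℚ :=
  ((arrangements (msetOf ms)).map fun w =>
    X 0 ^ des w * X 1 ^ ((msetOf ms).card + 1 - des w)).sum

/-- The multiset Eulerian polynomial `A_𝐦(x) = Σ_π x^{des π}`. -/
noncomputable def Auni (ms : List ℕ) : Polynomial ℚ :=
  ((arrangements (msetOf ms)).map fun w => Polynomial.X ^ des w).sum

section Insertion

/-- All words obtained from `w` by inserting one letter `m`, listed by position. -/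
def insertOne (m : ℕ) : List ℕ → List (List ℕ)
  | [] => [[m]]
  | a :: t => (m :: a :: t) :: (insertOne m t).map (a :: ·)

/-- All words obtained from `w` by inserting two letters `m`, listed by positions. -/
def insertTwo (m : ℕ) : List ℕ → List (List ℕ)
  | [] => [[m, m]]
  | a :: t => (insertOne m (a :: t)).map (m :: ·) ++ (insertTwo m t).map (a :: ·)

theorem mem_insertOne {m : ℕ} {w : List ℕ} (hw : m ∉ w) (v : List ℕ) :
    v ∈ insertOne m w ↔ v.filter (· ≠ m) = w ∧ v.count m = 1 := by
  induction w generalizing v with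
  | nil =>
    simp only [insertOne, List.mem_singleton]
    constructor
    · rintro rfl; simp
    · rintro ⟨h1, h2⟩
      have : ∀ x ∈ v, x = m := by simpa using h1
      rw [List.eq_replicate_of_mem this] at h2 ⊢
      simp at h2
      simp [h2]
  | cons a t ih =>
    have ham : a ≠ m := fun h => hw (by simp [h])
    have hmt : m ∉ t := fun h => hw (by simp [h])
    simp only [insertOne, List.mem_cons, List.mem_map]
    constructor
    · rintro (rfl | ⟨u, hu, rfl⟩)
      · have : (t.filter (· ≠ m)) = t := by
          rw [List.filter_eq_self]; intro x hx; simp; rintro rfl; exact hmt hx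
        simpa [ham, List.count_eq_zero.2 hmt] using this
      · obtain ⟨h1, h2⟩ := (ih hmt u).1 hu
        simpa [ham, h2] using h1
    · rintro ⟨h1, h2⟩
      cases v with
      | nil => simp at h1
      | cons c v =>
        by_cases hc : c = m
        · subst hc
          left
          have h3 : c ∉ v := by simpa [List.count_eq_zero] using h2
          have : (v.filter (· ≠ c)) = v := by
            rw [List.filter_eq_self]; intro x hx; simp; rintro rfl; exact h3 hx
          simp only [ne_eq, not_true_eq_false, decide_false, Bool.false_eq_true,
            not_false_eq_true, List.filter_cons_of_neg] at h1
          rw [← h1]; simpa using this.symm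
        · right
          simp only [ne_eq, hc, not_false_eq_true, decide_true, List.filter_cons_of_pos,
            List.cons.injEq] at h1
          refine ⟨v, (ih hmt v).2 ⟨h1.2, by simpa [hc] using h2⟩, by rw [h1.1]⟩

theorem mem_insertTwo {m : ℕ} {w : List ℕ} (hw : m ∉ w) (v : List ℕ) :
    v ∈ insertTwo m w ↔ v.filter (· ≠ m) = w ∧ v.count m = 2 := by
  induction w generalizing v with
  | nil =>
    simp only [insertTwo, List.mem_singleton]
    constructor
    · rintro rfl; simp
    · rintro ⟨h1, h2⟩
      have : ∀ x ∈ v, x = m := by simpa using h1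
      rw [List.eq_replicate_of_mem this] at h2 ⊢
      simp at h2
      simp [h2, List.replicate]
  | cons a t ih =>
    have ham : a ≠ m := fun h => hw (by simp [h])
    have hmt : m ∉ t := fun h => hw (by simp [h])
    simp only [insertTwo, List.mem_append, List.mem_map]
    constructor
    · rintro (⟨u, hu, rfl⟩ | ⟨u, hu, rfl⟩)
      · obtain ⟨h1, h2⟩ := (mem_insertOne hw u).1 hu
        simpa [h2] using h1
      · obtain ⟨h1, h2⟩ := (ih hmt u).1 hu
        simpa [ham, h2] using h1
    · rintro ⟨h1, h2⟩
      cases v with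
      | nil => simp at h1
      | cons c v =>
        by_cases hc : c = m
        · subst hc
          left
          refine ⟨v, (mem_insertOne hw v).2 ⟨by simpa using h1, by simpa using h2⟩, rfl⟩
        · right
          simp only [ne_eq, hc, not_false_eq_true, decide_true, List.filter_cons_of_pos,
            List.cons.injEq] at h1
          refine ⟨v, (ih hmt v).2 ⟨h1.2, by simpa [hc] using h2⟩, by rw [h1.1]⟩

theorem nodup_insertOne {m : ℕ} {w : List ℕ} (hw : m ∉ w) : (insertOne m w).Nodup := by
  induction w with
  | nil => simp [insertOne]
  | cons a t ih =>
    have ham : a ≠ m := fun h => hw (by simp [h])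
    have hmt : m ∉ t := fun h => hw (by simp [h])
    simp only [insertOne, List.nodup_cons, List.mem_map, not_exists, not_and]
    refine ⟨fun u _ h => ham (List.cons.inj h).1, (ih hmt).map ?_⟩
    exact List.cons_injective

theorem nodup_insertTwo {m : ℕ} {w : List ℕ} (hw : m ∉ w) : (insertTwo m w).Nodup := by
  induction w with
  | nil => simp [insertTwo]
  | cons a t ih =>
    have ham : a ≠ m := fun h => hw (by simp [h])
    have hmt : m ∉ t := fun h => hw (by simp [h])
    refine List.Nodup.append ((nodup_insertOne hw).map List.cons_injective)
      ((ih hmt).map List.cons_injective) ?_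
    intro v h1 h2
    obtain ⟨u, _, rfl⟩ := List.mem_map.1 h1
    obtain ⟨u', _, h⟩ := List.mem_map.1 h2
    exact ham (List.cons.inj h).1

/-- Inserting a letter at least as large as all others keeps the number of descents when
done at a descent and increases it by one otherwise. -/
theorem sum_insertOne {m : ℕ} (hm : 0 < m) (w : List ℕ) (hw : ∀ a ∈ w, a < m)
    (p : ℕ) (hp : p ≤ m) :
    ((insertOne m w).map fun v => (Polynomial.X : Polynomial ℚ) ^ desAux (p :: (v ++ [0]))).sum =
      ((desAux (p :: (w ++ [0])) : ℕ) : Polynomial ℚ) * Polynomial.X ^ desAux (p :: (w ++ [0])) +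
      ((w.length : Polynomial ℚ) + 1 -
        ((desAux (p :: (w ++ [0])) : ℕ) : Polynomial ℚ)) *
        Polynomial.X ^ (desAux (p :: (w ++ [0])) + 1) := by
  induction w generalizing p with
  | nil =>
    have h1 : ¬ m < p := by omega
    rcases Nat.eq_zero_or_pos p with h | h <;> simp [insertOne, desAux, h1, hm, h]
  | cons a t ih =>
    have h1 : ¬ m < p := by omega
    have h2 : a < m := hw a (by simp)
    have := ih (fun b hb => hw b (by simp [hb])) a h2.le
    simp only [insertOne, List.map_cons, List.sum_cons, List.map_map, Function.comp_def,
      List.cons_append, desAux, h1, h2, if_true, if_false, pow_add, List.sum_map_mul_left,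
      List.length_cons] at this ⊢
    rw [this]
    split_ifs <;> push_cast <;> ring

theorem sum_insertTwo {m : ℕ} (hm : 0 < m) (w : List ℕ) (hw : ∀ a ∈ w, a < m)
    (p : ℕ) (hp : p ≤ m) (d : ℕ) (hd : desAux (p :: (w ++ [0])) = d) :
    2 * ((insertTwo m w).map fun v =>
        (Polynomial.X : Polynomial ℚ) ^ desAux (p :: (v ++ [0]))).sum =
      (d : Polynomial ℚ) * ((d : Polynomial ℚ) + 1) * Polynomial.X ^ d +
      2 * ((d : Polynomial ℚ) + 1) * ((w.length : Polynomial ℚ) + 1 - (d : Polynomial ℚ)) * Polynomial.X ^ (d + 1) +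
      ((w.length : Polynomial ℚ) + 1 - (d : Polynomial ℚ)) *
        ((w.length : Polynomial ℚ) - (d : Polynomial ℚ)) * Polynomial.X ^ (d + 2) := by
  induction w generalizing p d with
  | nil =>
    have h1 : ¬ m < p := by omega
    subst hd
    rcases Nat.eq_zero_or_pos p with h | h <;> simp [insertTwo, desAux, h1, hm, h] <;> ring
  | cons a t ih =>
    have h1 : ¬ m < p := by omega
    have h2 : a < m := hw a (by simp)
    have e1 := sum_insertOne hm (a :: t) hw m le_rfl
    have e2 := ih (fun b hb => hw b (by simp [hb])) a h2.le _ rfl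
    subst hd
    simp only [insertTwo, List.map_append, List.sum_append, List.map_map, Function.comp_def,
      List.cons_append, desAux, h1, h2, if_true, if_false, pow_add, List.sum_map_mul_left,
      List.length_cons, pow_zero, one_mul, mul_add (2 : Polynomial ℚ)] at e1 e2 ⊢
    rw [e1]
    split_ifs
    · push_cast
      linear_combination Polynomial.X * e2
    · push_cast
      linear_combination e2

end Insertion

section Multiset

theorem mem_arrangements {M : Multiset ℕ} {w : List ℕ} :
    w ∈ arrangements M ↔ (w : Multiset ℕ) = M := by
  rw [arrangements, List.mem_dedup, List.mem_permutations, ← Multiset.coe_eq_coe,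
    Multiset.coe_toList]

theorem msetOf_replicate_two (n : ℕ) : msetOf (List.replicate n 2) =
    ((List.range n).flatMap fun i => List.replicate 2 (i + 1) : List ℕ) := by
  rw [msetOf, List.length_replicate]
  congr 1
  refine List.flatMap_congr fun i hi => ?_
  rw [List.mem_range] at hi
  simp [List.getD_eq_getElem?_getD, hi]

theorem msetOf_replicate_two_succ (n : ℕ) : msetOf (List.replicate (n + 1) 2) =
    msetOf (List.replicate n 2) + Multiset.replicate 2 (n + 1) := by
  rw [msetOf_replicate_two, msetOf_replicate_two, List.range_succ, List.flatMap_append,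
    ← Multiset.coe_add]
  rfl

theorem card_msetOf_replicate_two (n : ℕ) : (msetOf (List.replicate n 2)).card = 2 * n := by
  simp [msetOf_replicate_two, mul_comm]

theorem lt_of_mem_msetOf_replicate_two {n a : ℕ} (h : a ∈ msetOf (List.replicate n 2)) :
    a < n + 1 := by
  rw [msetOf_replicate_two] at h
  simp at h
  omega

theorem arrangements_succ_perm (n : ℕ) :
    (arrangements (msetOf (List.replicate (n + 1) 2))).Perm
      ((arrangements (msetOf (List.replicate n 2))).flatMap (insertTwo (n + 1))) := by
  have hnot : ∀ w ∈ arrangements (msetOf (List.replicate n 2)), n + 1 ∉ w := by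
    intro w hw h
    rw [mem_arrangements] at hw
    exact lt_irrefl _ (lt_of_mem_msetOf_replicate_two (hw ▸ Multiset.mem_coe.2 h))
  have hnot' : n + 1 ∉ msetOf (List.replicate n 2) := fun h =>
    lt_irrefl _ (lt_of_mem_msetOf_replicate_two h)
  refine (List.perm_ext_iff_of_nodup (List.nodup_dedup _) ?_).2 ?_
  rotate_left
  · intro v
    change v ∈ arrangements _ ↔ _
    rw [List.mem_flatMap, mem_arrangements, msetOf_replicate_two_succ]
    constructor
    · intro h
      refine ⟨v.filter (· ≠ n + 1), ?_, ?_⟩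
      · rw [mem_arrangements, ← Multiset.filter_coe, h, Multiset.filter_add,
          Multiset.filter_eq_self.2 (fun a ha => by rintro rfl; exact hnot' ha),
          Multiset.filter_eq_nil.2 (fun a ha => by simp [Multiset.eq_of_mem_replicate ha]),
          add_zero]
      · refine (mem_insertTwo (by simp) v).2 ⟨rfl, ?_⟩
        rw [← Multiset.coe_count, h, Multiset.count_add, Multiset.count_replicate_self,
          Multiset.count_eq_zero.2 hnot']
    · rintro ⟨w, hw, hv⟩
      obtain ⟨h1, h2⟩ := (mem_insertTwo (hnot w hw) v).1 hv
      rw [mem_arrangements] at hw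
      rw [← hw, ← h1, ← Multiset.filter_coe, ← h2, ← Multiset.coe_count,
        ← Multiset.filter_eq', add_comm]
      exact (Multiset.filter_add_not _ _).symm
  · rw [List.nodup_flatMap]
    refine ⟨fun w hw => nodup_insertTwo (hnot w hw), ?_⟩
    refine (List.nodup_dedup _).imp_of_mem ?_
    intro a b ha hb hab v h1 h2
    exact hab (((mem_insertTwo (hnot a ha) v).1 h1).1.symm.trans
      ((mem_insertTwo (hnot b hb) v).1 h2).1)

end Multiset

section Recurrence

open Polynomial (derivative)

/-- The Euler operator `x d/dx`. -/
noncomputable def eulerOp (p : Polynomial ℚ) : Polynomial ℚ := Polynomial.X * derivative p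

theorem eulerOp_add (p q : Polynomial ℚ) : eulerOp (p + q) = eulerOp p + eulerOp q := by
  simp [eulerOp, mul_add]

theorem eulerOp_mul (p q : Polynomial ℚ) :
    eulerOp (p * q) = eulerOp p * q + p * eulerOp q := by
  simp [eulerOp]; ring

theorem eulerOp_natCast (k : ℕ) : eulerOp (k : Polynomial ℚ) = 0 := by
  simp [eulerOp]

theorem eulerOp_X_pow (k : ℕ) :
    eulerOp (Polynomial.X ^ k) = (k : Polynomial ℚ) * Polynomial.X ^ k := by
  cases k with
  | zero => simp [eulerOp]
  | succ k => simp [eulerOp]; ring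

theorem eulerOp_one_add_X_pow (k : ℕ) : eulerOp ((1 + Polynomial.X) ^ (k + 1)) =
    ((k + 1 : ℕ) : Polynomial ℚ) * (Polynomial.X * (1 + Polynomial.X) ^ k) := by
  simp [eulerOp, Polynomial.derivative_pow_succ]; ring

theorem eulerOp_X : eulerOp Polynomial.X = Polynomial.X := by
  simp [eulerOp]

/-- The operator taking the descent polynomial of `(1², …, n²)` to that of
`(1², …, (n+1)²)`, in terms of the Euler operator. -/
noncomputable def descentStep (n : ℕ) : Polynomial ℚ →+ Polynomial ℚ :=
  AddMonoidHom.mk' (fun p => Polynomial.C (1 / 2) *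
    (eulerOp p + eulerOp (eulerOp p) +
      2 * Polynomial.X * (((2 * n + 1 : ℕ) : Polynomial ℚ) * (p + eulerOp p) -
        eulerOp p - eulerOp (eulerOp p)) +
      Polynomial.X ^ 2 * (((2 * n + 1 : ℕ) : Polynomial ℚ) * ((2 * n : ℕ) : Polynomial ℚ) * p -
        ((4 * n + 1 : ℕ) : Polynomial ℚ) * eulerOp p + eulerOp (eulerOp p))))
    (fun p q => by simp only [eulerOp_add]; ring)

theorem two_mul_descentStep (n : ℕ) (p : Polynomial ℚ) : 2 * descentStep n p =
    eulerOp p + eulerOp (eulerOp p) +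
      2 * Polynomial.X * (((2 * n + 1 : ℕ) : Polynomial ℚ) * (p + eulerOp p) -
        eulerOp p - eulerOp (eulerOp p)) +
      Polynomial.X ^ 2 * (((2 * n + 1 : ℕ) : Polynomial ℚ) * ((2 * n : ℕ) : Polynomial ℚ) * p -
        ((4 * n + 1 : ℕ) : Polynomial ℚ) * eulerOp p + eulerOp (eulerOp p)) := by
  have h : (2 : Polynomial ℚ) * Polynomial.C (1 / 2) = 1 := by
    rw [← Polynomial.C_ofNat, ← Polynomial.C_mul]; norm_num
  simp only [descentStep, AddMonoidHom.mk'_apply]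
  rw [← mul_assoc, h, one_mul]

theorem two_mul_descentStep_X_pow (n d : ℕ) :
    2 * descentStep n (Polynomial.X ^ d) =
      (d : Polynomial ℚ) * ((d : Polynomial ℚ) + 1) * Polynomial.X ^ d +
      2 * ((d : Polynomial ℚ) + 1) * (((2 * n : ℕ) : Polynomial ℚ) + 1 - (d : Polynomial ℚ)) *
        Polynomial.X ^ (d + 1) +
      (((2 * n : ℕ) : Polynomial ℚ) + 1 - (d : Polynomial ℚ)) *
        (((2 * n : ℕ) : Polynomial ℚ) - (d : Polynomial ℚ)) * Polynomial.X ^ (d + 2) := by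
  rw [two_mul_descentStep]
  simp only [eulerOp_mul, eulerOp_X_pow, eulerOp_natCast]
  push_cast
  ring

theorem Auni_succ (n : ℕ) :
    Auni (List.replicate (n + 1) 2) = descentStep n (Auni (List.replicate n 2)) := by
  rw [Auni, ((arrangements_succ_perm n).map _).sum_eq, Auni, map_list_sum, List.map_map,
    List.map_flatMap, List.flatMap_def, List.sum_flatten, List.map_map]
  congr 1
  refine List.map_congr_left fun w hw => ?_
  rw [mem_arrangements] at hw
  have hlen : w.length = 2 * n := by
    rw [← card_msetOf_replicate_two, ← hw, Multiset.coe_card]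
  have h2 : (2 : Polynomial ℚ) ≠ 0 := two_ne_zero
  apply mul_left_cancel₀ h2
  simp only [Function.comp_apply]
  rw [two_mul_descentStep_X_pow]
  have := sum_insertTwo n.succ_pos w
    (fun a ha => lt_of_mem_msetOf_replicate_two (hw ▸ Multiset.mem_coe.2 ha)) 0
    (Nat.zero_le _) (des w) rfl
  rw [hlen] at this
  exact this

theorem Auni_nil : Auni [] = 1 := by
  have h : arrangements (msetOf []) = [[]] := by
    simp [arrangements, msetOf]
  simp [Auni, h, des, desAux]

theorem two_mul_cast_succ_choose_two (k : ℕ) :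
    (2 : Polynomial ℚ) * (((k + 1).choose 2 : ℕ) : Polynomial ℚ) =
      ((k : Polynomial ℚ) + 1) * (k : Polynomial ℚ) := by
  induction k with
  | zero => simp
  | succ k ih =>
    rw [Nat.choose_succ_succ' (k + 1) 1, Nat.choose_one_right, Nat.cast_add, mul_add, ih]
    push_cast
    ring

theorem descentStep_gamma_top (n : ℕ) :
    descentStep n (Polynomial.X ^ n) =
      (n + 1).choose 2 • (Polynomial.X ^ n * (1 + Polynomial.X) ^ 2) +
      (n + 1) • Polynomial.X ^ (n + 1) := by
  have h2 : (2 : Polynomial ℚ) ≠ 0 := two_ne_zero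
  apply mul_left_cancel₀ h2
  have hc := two_mul_cast_succ_choose_two n
  simp only [two_mul_descentStep_X_pow, nsmul_eq_mul, mul_add, ← mul_assoc, hc]
  push_cast
  ring

theorem descentStep_gamma (k j : ℕ) :
    descentStep (k + j + 1) (Polynomial.X ^ k * (1 + Polynomial.X) ^ (2 * j + 2)) =
      (k + 1).choose 2 • (Polynomial.X ^ k * (1 + Polynomial.X) ^ (2 * j + 4)) +
      ((k + 1) * (4 * j + 5)) •
        (Polynomial.X ^ (k + 1) * (1 + Polynomial.X) ^ (2 * j + 2)) +
      (4 * (j + 1) * (2 * j + 1)) •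
        (Polynomial.X ^ (k + 2) * (1 + Polynomial.X) ^ (2 * j)) := by
  have h2 : (2 : Polynomial ℚ) ≠ 0 := two_ne_zero
  apply mul_left_cancel₀ h2
  have hc := two_mul_cast_succ_choose_two k
  simp only [two_mul_descentStep, nsmul_eq_mul, mul_add, ← mul_assoc, hc]
  simp only [eulerOp_mul, eulerOp_add, eulerOp_X_pow, eulerOp_X, eulerOp_natCast,
    eulerOp_one_add_X_pow]
  push_cast
  ring

end Recurrence

section Gamma

/-- The cone of polynomials with a γ-expansion `Σ_{k=1}^n b_k x^k (1+x)^{2n-2k}`, `b_k ∈ ℕ`. -/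
noncomputable def gammaCone (n : ℕ) : AddSubmonoid (Polynomial ℚ) :=
  AddSubmonoid.closure
    ((fun k => Polynomial.X ^ k * (1 + Polynomial.X) ^ (2 * n - 2 * k)) '' Set.Icc 1 n)

theorem gamma_mem {n k e : ℕ} (h1 : 1 ≤ k) (h2 : k ≤ n) (he : e = 2 * n - 2 * k) :
    Polynomial.X ^ k * (1 + Polynomial.X) ^ e ∈ gammaCone n :=
  AddSubmonoid.subset_closure ⟨k, ⟨h1, h2⟩, by rw [he]⟩

theorem descentStep_mem {n : ℕ} {p : Polynomial ℚ} (hp : p ∈ gammaCone n) :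
    descentStep n p ∈ gammaCone (n + 1) := by
  induction hp using AddSubmonoid.closure_induction with
  | zero => simp
  | add p q _ _ hp hq => rw [map_add]; exact add_mem hp hq
  | mem p hp =>
    obtain ⟨k, ⟨h1, h2⟩, rfl⟩ := hp
    dsimp only
    obtain ⟨m, rfl⟩ := Nat.exists_eq_add_of_le h2
    cases m with
    | zero =>
      simp only [add_zero, Nat.sub_self, pow_zero, mul_one, descentStep_gamma_top]
      refine add_mem (nsmul_mem (gamma_mem h1 (by omega) (by omega)) _) (nsmul_mem ?_ _)
      simpa using gamma_mem (n := k + 1) (k := k + 1) (by omega) le_rfl rfl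
    | succ j =>
      have : 2 * (k + (j + 1)) - 2 * k = 2 * j + 2 := by omega
      rw [this, ← add_assoc, descentStep_gamma]
      exact add_mem (add_mem (nsmul_mem (gamma_mem h1 (by omega) (by omega)) _)
        (nsmul_mem (gamma_mem (by omega) (by omega) (by omega)) _))
        (nsmul_mem (gamma_mem (by omega) (by omega) (by omega)) _)

theorem Auni_mem_gammaCone {n : ℕ} (hn : 1 ≤ n) :
    Auni (List.replicate n 2) ∈ gammaCone n := by
  induction n, hn using Nat.le_induction with
  | base =>
    have h := descentStep_gamma_top 0
    rw [Auni_succ, List.replicate_zero, Auni_nil]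
    simp only [pow_zero] at h
    rw [h]
    simpa using gamma_mem (n := 1) (k := 1) le_rfl le_rfl rfl
  | succ n _ ih => rw [Auni_succ]; exact descentStep_mem ih

open Finset in
theorem exists_coeff_of_mem_gammaCone {n : ℕ} {p : Polynomial ℚ} (hp : p ∈ gammaCone n) :
    ∃ b : ℕ → ℕ, p = ∑ k ∈ Icc 1 n,
      Polynomial.C ((b k : ℚ)) * Polynomial.X ^ k *
        (1 + Polynomial.X) ^ (2 * n - 2 * k) := by
  induction hp using AddSubmonoid.closure_induction with
  | zero => exact ⟨0, by simp⟩
  | add p q _ _ hp hq =>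
    obtain ⟨b, rfl⟩ := hp
    obtain ⟨c, rfl⟩ := hq
    refine ⟨b + c, ?_⟩
    rw [← sum_add_distrib]
    refine sum_congr rfl fun k _ => ?_
    simp only [Pi.add_apply, Nat.cast_add, map_add]
    ring
  | mem p hp =>
    obtain ⟨k, hk, rfl⟩ := hp
    refine ⟨Pi.single k 1, ?_⟩
    rw [sum_eq_single_of_mem k (mem_Icc.2 hk)]
    · simp
    · intro j _ hj
      simp [hj]

/-- Homogenization `x^d ↦ x^d y^{N-d}`. -/
noncomputable def homogenizeDeg (N : ℕ) : Polynomial ℚ →ₗ[ℚ] MvPolynomial (Fin 2) ℚ :=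
  (Polynomial.basisMonomials ℚ).constr ℚ fun d => X 0 ^ d * X 1 ^ (N - d)

theorem homogenizeDeg_X_pow (N d : ℕ) :
    homogenizeDeg N (Polynomial.X ^ d) = X 0 ^ d * X 1 ^ (N - d) := by
  have : (Polynomial.X ^ d : Polynomial ℚ) = Polynomial.basisMonomials ℚ d := by
    simp [Polynomial.X_pow_eq_monomial]
  rw [this, homogenizeDeg, Module.Basis.constr_basis]

theorem homogenizeDeg_Auni (ms : List ℕ) :
    homogenizeDeg ((msetOf ms).card + 1) (Auni ms) = Abi ms := by
  rw [Auni, Abi, map_list_sum, List.map_map]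
  congr 1
  exact List.map_congr_left fun w _ => homogenizeDeg_X_pow _ _

theorem homogenizeDeg_gamma {n k : ℕ} (hk : k ≤ n) :
    homogenizeDeg (2 * n + 1)
        (Polynomial.X ^ k * (1 + Polynomial.X) ^ (2 * n - 2 * k)) =
      X 1 * ((X 0 * X 1) ^ k * (X 0 + X 1) ^ (2 * n - 2 * k)) := by
  rw [add_comm 1 Polynomial.X, add_pow, add_pow, Finset.mul_sum, Finset.mul_sum, Finset.mul_sum,
    map_sum]
  refine Finset.sum_congr rfl fun i hi => ?_
  rw [Finset.mem_range] at hi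
  have h1 : (Polynomial.X : Polynomial ℚ) ^ k * (Polynomial.X ^ i * 1 ^ (2 * n - 2 * k - i) *
      (((2 * n - 2 * k).choose i : ℕ) : Polynomial ℚ)) =
      (2 * n - 2 * k).choose i • Polynomial.X ^ (k + i) := by
    rw [nsmul_eq_mul, one_pow]; ring
  rw [h1, map_nsmul, homogenizeDeg_X_pow, nsmul_eq_mul,
    show 2 * n + 1 - (k + i) = 1 + k + (2 * n - 2 * k - i) by omega]
  ring

end Gamma

open Finset in
/-- For `𝐦 = (2,2,…,2)` (`n` twos), `A_𝐦(x,y) = y·Σ_{k=1}^{n} b(n,k)(xy)^k(x+y)^{2n-2k}`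
with nonnegative integers `b(n,k)`; in particular the univariate polynomial
`A_𝐦(x) = Σ_k b(n,k) x^k (1+x)^{2n-2k}` is γ-positive. -/
theorem Abi_all_twos_gamma_positive (n : ℕ) (hn : 1 ≤ n) :
    ∃ b : ℕ → ℕ,
      Abi (List.replicate n 2) =
        X 1 * ∑ k ∈ Icc 1 n, C ((b k : ℚ)) * (X 0 * X 1) ^ k * (X 0 + X 1) ^ (2 * n - 2 * k) ∧
      Auni (List.replicate n 2) =
        ∑ k ∈ Icc 1 n,
          Polynomial.C ((b k : ℚ)) * Polynomial.X ^ k * (1 + Polynomial.X) ^ (2 * n - 2 * k) := by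
  obtain ⟨b, hb⟩ := exists_coeff_of_mem_gammaCone (Auni_mem_gammaCone hn)
  refine ⟨b, ?_, hb⟩
  rw [← homogenizeDeg_Auni, card_msetOf_replicate_two, hb, map_sum, mul_sum]
  refine sum_congr rfl fun k hk => ?_
  rw [mul_assoc, ← Polynomial.smul_eq_C_mul, map_smul, homogenizeDeg_gamma (mem_Icc.1 hk).2,
    MvPolynomial.smul_eq_C_mul]
  ring
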